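/- Let Γ be a countably infinite group which has no finite-index normal subgroup isomorphic to ℤ or to ℤ², let f ∈ ℤΓ be well-balanced, and let (Γ_n)_{n≥1} be a sequence of finite-index normal subgroups of Γ with ⋂_{n≥1} ⋃_{i≥n} Γ_i = {e}. Let λ_n be the Haar probability measure of the compact group Fix_{Γ_n}(X_f), regarded as a Borel probability measure on X_f, and λ the Haar probability measure of X_f. Then for every continuous function p : X_f → ℝ and every δ > 0, λ_n({x ∈ Fix_{Γ_n}(X_f) : |[Γ:Γ_n]^{-1} Σ_{c ∈ Γ/Γ_n} p(s_c·x) − ∫ p dλ| > δ}) → 0 as n → ∞, where for each coset c ∈ Γ/Γ_n, s_c ∈ Γ is any representative of c (the value p(s_c·x) does not depend on the choice since x is Γ_n-fixed). -/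

import Mathlib

open Filter Topology MeasureTheory

/-- `f ∈ ℤΓ` is well-balanced. -/
def WellBalancedZ {G : Type*} [Group G] (f : G → ℤ) : Prop :=
  (Function.support f).Finite ∧ (∑ᶠ s : G, f s) = 0 ∧
    (∀ s : G, s ≠ 1 → f s ≤ 0) ∧ (∀ s : G, f s⁻¹ = f s) ∧
    Subgroup.closure (Function.support f) = ⊤

/-- `X_f = {x ∈ (ℝ/ℤ)^Γ : ∀ t, ∑_s f_s · x_{ts} = 0}`. -/
def XfSet {G : Type*} [Group G] (f : G → ℤ) : Set (G → UnitAddCircle) :=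
  {x | ∀ t : G, (∑ᶠ s : G, f s • x (t * s)) = 0}

/-- `Fix_N(X_f) = {x ∈ X_f : x_{γt} = x_t for all γ ∈ N, t ∈ Γ}`. -/
def fixSet {G : Type*} [Group G] (f : G → ℤ) (N : Subgroup G) :
    Set (G → UnitAddCircle) :=
  {x | x ∈ XfSet f ∧ ∀ γ ∈ N, ∀ t : G, x (γ * t) = x t}

/-- The empirical average `[Γ:Γ_n]⁻¹ ∑_{c ∈ Γ/Γ_n} p(s_c·x)`, where `s_c` is a
representative of the coset `c` and `(s·x)_t = x_{s⁻¹t}`. -/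
noncomputable def empAvg {G : Type*} [Group G] (N : Subgroup G)
    (p : (G → UnitAddCircle) → ℝ) (x : G → UnitAddCircle) : ℝ :=
  (N.index : ℝ)⁻¹ * ∑ᶠ c : G ⧸ N, p (fun t => x ((Quotient.out c)⁻¹ * t))

open scoped Pointwise Finset

section Growth

variable {G : Type*} [Group G] [DecidableEq G] {T : Finset G}

lemma exists_mem_pow_succ_notMem (h1 : 1 ∈ T) (hcl : Subgroup.closure (T : Set G) = ⊤)
    {k : ℕ} {q : G} (hq : q ∉ T ^ k) : ∃ y ∈ T ^ (k + 1), y ∉ T ^ k := by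
  rcases Finset.eq_singleton_or_nontrivial h1 with rfl | hT
  · have hq1 : q ∈ Subgroup.closure (({1} : Finset G) : Set G) := by rw [hcl]; trivial
    rw [Finset.coe_singleton, Subgroup.closure_singleton_one, Subgroup.mem_bot] at hq1
    simp [hq1] at hq
  · have hne : (T ^ k : Set G) ≠ Subgroup.closure (T : Set G) := by
      intro h
      rw [hcl] at h
      apply hq
      have : q ∈ (T ^ k : Set G) := by rw [h]; trivial
      exact_mod_cast this
    obtain ⟨y, hy, hy'⟩ :=
      Finset.exists_of_ssubset (Finset.pow_ssubset_pow_succ_of_pow_ne_closure h1 hT hne)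
    exact ⟨y, hy, hy'⟩

lemma inv_mem_pow (hs : T⁻¹ = T) {n : ℕ} {y : G} (hy : y ∈ T ^ n) : y⁻¹ ∈ T ^ n := by
  rw [← hs, inv_pow, Finset.mem_inv']
  simpa using hy

lemma exists_mem_pow (hs : T⁻¹ = T) (hcl : Subgroup.closure (T : Set G) = ⊤)
    (y : G) : ∃ n : ℕ, y ∈ T ^ n := by
  have hy : y ∈ Subgroup.closure (T : Set G) := by rw [hcl]; trivial
  induction hy using Subgroup.closure_induction with
  | mem x hx => exact ⟨1, by simpa using hx⟩
  | one => exact ⟨0, by simp⟩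
  | mul a b _ _ ha hb =>
    obtain ⟨m, hm⟩ := ha
    obtain ⟨n, hn⟩ := hb
    exact ⟨m + n, by rw [pow_add]; exact Finset.mul_mem_mul hm hn⟩
  | inv a _ ha =>
    obtain ⟨m, hm⟩ := ha
    exact ⟨m, inv_mem_pow hs hm⟩

lemma exists_finset_subset_pow (h1 : 1 ∈ T) (hs : T⁻¹ = T)
    (hcl : Subgroup.closure (T : Set G) = ⊤) (A : Finset G) : ∃ n : ℕ, A ⊆ T ^ n := by
  choose n hn using exists_mem_pow hs hcl
  exact ⟨A.sup n, fun a ha => Finset.pow_subset_pow_right h1 (Finset.le_sup ha) (hn a)⟩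

/-- Linear lower bound for the growth, with slope given by the size of a fixed ball. -/
lemma min_card_le_card_pow [Fintype G] (h1 : 1 ∈ T) (hs : T⁻¹ = T)
    (hcl : Subgroup.closure (T : Set G) = ⊤) {r m : ℕ} (hm : m ≤ #(T ^ r)) (j : ℕ) :
    min (Fintype.card G) (j * m) ≤ #(T ^ (j * (2 * r + 1))) := by
  induction j with
  | zero => simp
  | succ j ih =>
    by_cases hall : ∃ q, q ∉ T ^ ((j + 1) * (2 * r + 1))
    · obtain ⟨q, hq⟩ := hall
      have hq' : q ∉ T ^ (j * (2 * r + 1) + r) := fun h =>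
        hq (Finset.pow_subset_pow_right h1 (by nlinarith) h)
      obtain ⟨y, hy, hy'⟩ := exists_mem_pow_succ_notMem h1 hcl hq'
      have hjall : #(T ^ (j * (2 * r + 1))) < Fintype.card G :=
        Finset.card_lt_univ_of_notMem (x := q) fun h =>
          hq (Finset.pow_subset_pow_right h1 (by nlinarith) h)
      have hdis : Disjoint (T ^ (j * (2 * r + 1))) (y • T ^ r) := by
        rw [Finset.disjoint_left]
        intro b hb hb'
        obtain ⟨t, ht, rfl⟩ := Finset.mem_smul_finset.1 hb'
        apply hy'
        rw [pow_add]
        simpa using Finset.mul_mem_mul hb (inv_mem_pow hs ht)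
      have hsub : T ^ (j * (2 * r + 1)) ∪ y • T ^ r ⊆ T ^ ((j + 1) * (2 * r + 1)) := by
        apply Finset.union_subset
        · exact Finset.pow_subset_pow_right h1 (by nlinarith)
        · intro b hb
          obtain ⟨t, ht, rfl⟩ := Finset.mem_smul_finset.1 hb
          have : (j + 1) * (2 * r + 1) = (j * (2 * r + 1) + r + 1) + r := by ring
          rw [this, pow_add]
          exact Finset.mul_mem_mul hy ht
      have := Finset.card_le_card hsub
      rw [Finset.card_union_of_disjoint hdis, Finset.card_smul_finset] at this
      have h3 : (j + 1) * m = j * m + m := by ring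
      omega
    · push Not at hall
      have : T ^ ((j + 1) * (2 * r + 1)) = Finset.univ := by ext; simp [hall]
      rw [this, Finset.card_univ]
      exact min_le_left _ _

/-- Word length with respect to a generating set. -/
lemma exists_wordLength (h1 : 1 ∈ T) (hs : T⁻¹ = T) (hcl : Subgroup.closure (T : Set G) = ⊤) :
    ∃ l : G → ℕ, (∀ y n, l y ≤ n ↔ y ∈ T ^ n) ∧ (∀ x y, l (x * y) ≤ l x + l y) := by
  classical
  have H := exists_mem_pow hs hcl
  have key : ∀ y n, Nat.find (H y) ≤ n ↔ y ∈ T ^ n := fun y n =>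
    ⟨fun h => Finset.pow_subset_pow_right h1 h (Nat.find_spec (H y)), fun h => Nat.find_le h⟩
  refine ⟨fun y => Nat.find (H y), key, fun x y => ?_⟩
  rw [key, pow_add]
  exact Finset.mul_mem_mul (Nat.find_spec (H x)) (Nat.find_spec (H y))

lemma exists_geodesic {l : G → ℕ} (hl : ∀ y n, l y ≤ n ↔ y ∈ T ^ n)
    (hmul : ∀ x y, l (x * y) ≤ l x + l y) (L : ℕ) :
    ∀ y, l y = L → ∃ x : ℕ → G, (∀ i ≤ L, l (x i) = i) ∧ x L = y ∧
      ∀ i < L, (x i)⁻¹ * x (i + 1) ∈ T := by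
  induction L with
  | zero => exact fun y hy => ⟨fun _ => y, by simp [hy], rfl, by simp⟩
  | succ L ih =>
    intro y hy
    have hyT := (hl y (L + 1)).1 hy.le
    rw [pow_succ] at hyT
    obtain ⟨y', hy', t, ht, rfl⟩ := Finset.mem_mul.1 hyT
    have ht1 : l t ≤ 1 := (hl t 1).2 (by simpa using ht)
    have hy'L : l y' ≤ L := (hl y' L).2 hy'
    obtain ⟨x, hx, hxL, hstep⟩ := ih y' (by have := hmul y' t; omega)
    refine ⟨fun i => if i ≤ L then x i else y' * t, ?_, by simp, ?_⟩
    · intro i hi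
      by_cases h : i ≤ L
      · simp [h, hx i h]
      · obtain rfl : i = L + 1 := by omega
        simpa using hy
    · intro i hi
      rcases Nat.lt_or_eq_of_le (Nat.le_of_lt_succ hi) with h | rfl
      · have h' : i ≤ L := h.le
        have h'' : i + 1 ≤ L := h
        simpa [h', h''] using hstep i h
      · simpa [hxL] using ht

/-- An infinite finitely generated group has a geodesic ray. -/
lemma exists_geodesic_ray [Infinite G] (h1 : 1 ∈ T)
    (hcl : Subgroup.closure (T : Set G) = ⊤)
    {l : G → ℕ} (hl : ∀ y n, l y ≤ n ↔ y ∈ T ^ n)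
    (hmul : ∀ x y, l (x * y) ≤ l x + l y) :
    ∃ x : ℕ → G, (∀ i, l (x i) = i) ∧ ∀ i, (x i)⁻¹ * x (i + 1) ∈ T := by
  have hsphere : ∀ L, ∃ y, l y = L := by
    intro L
    rcases L with _ | L
    · exact ⟨1, by have := (hl 1 0).2 (by simp); omega⟩
    · obtain ⟨q, hq⟩ := Infinite.exists_notMem_finset (T ^ L)
      obtain ⟨y, hy, hy'⟩ := exists_mem_pow_succ_notMem h1 hcl hq
      rw [← hl] at hy hy'
      exact ⟨y, by omega⟩
  choose y hy using hsphere
  choose xs hxs _ hstep using fun L => exists_geodesic hl hmul L (y L) (hy L)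
  have hge : ∀ i : ℕ, ∀ᶠ L in (hyperfilter ℕ : Filter ℕ), i < L := fun i =>
    (Nat.hyperfilter_le_atTop) (eventually_gt_atTop i)
  have hlim : ∀ i, ∃ g, ∀ᶠ L in (hyperfilter ℕ : Filter ℕ), xs L i = g := by
    intro i
    have : ∀ᶠ L in (hyperfilter ℕ : Filter ℕ), ∃ g ∈ ((T ^ i : Finset G) : Set G), xs L i = g := by
      filter_upwards [hge i] with L hL
      exact ⟨xs L i, Finset.mem_coe.2 ((hl _ i).1 (hxs L i hL.le).le), rfl⟩
    have := (Ultrafilter.eventually_exists_mem_iff (T ^ i).finite_toSet).1 this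
    obtain ⟨g, _, hg⟩ := this
    exact ⟨g, hg⟩
  choose x hx using hlim
  refine ⟨x, fun i => ?_, fun i => ?_⟩
  · obtain ⟨L, hL, h⟩ := ((hge i).and (hx i)).exists
    rw [← h, hxs L i hL.le]
  · obtain ⟨L, hL, h, h'⟩ := ((hge i).and ((hx i).and (hx (i + 1)))).exists
    rw [← h, ← h']
    exact hstep L i hL

/-- An infinite group generated by `T`, infinitely many of whose spheres have bounded size, has an
element of infinite order. -/
lemma exists_pow_ne_one_of_card_sphere_le [Infinite G] (h1 : 1 ∈ T) (hs : T⁻¹ = T)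
    (hcl : Subgroup.closure (T : Set G) = ⊤) {c : ℕ}
    (hc : ∃ᶠ n in atTop, #(T ^ (n + 1) \ T ^ n) ≤ c) :
    ∃ z : G, ∀ k : ℕ, z ^ k = 1 → k = 0 := by
  obtain ⟨l, hl, hmul⟩ := exists_wordLength h1 hs hcl
  obtain ⟨x, hx, hstep⟩ := exists_geodesic_ray h1 hcl hl hmul
  have hseg : ∀ i n, l ((x i)⁻¹ * x (i + n)) = n := by
    intro i n
    apply le_antisymm
    · rw [hl]
      induction n with
      | zero => simp
      | succ n ih =>
        rw [pow_succ]
        have := Finset.mul_mem_mul ih (hstep (i + n))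
        simpa [mul_assoc, add_assoc] using this
    · have := hmul (x i) ((x i)⁻¹ * x (i + n))
      rw [mul_inv_cancel_left, hx, hx] at this
      omega
  have hpair : ∃ᶠ n in atTop, ∃ p : Fin (c + 1) × Fin (c + 1), p.1 < p.2 ∧
      (x p.1)⁻¹ * x (p.1 + (n + 1)) = (x p.2)⁻¹ * x (p.2 + (n + 1)) := by
    refine hc.mono fun n hn => ?_
    obtain ⟨i, -, j, -, hij, h⟩ := Finset.exists_ne_map_eq_of_card_lt_of_maps_to
      (s := (Finset.univ : Finset (Fin (c + 1)))) (t := T ^ (n + 1) \ T ^ n)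
      (f := fun i => (x i)⁻¹ * x (i + (n + 1))) (by simpa using Nat.lt_succ_of_le hn)
      (fun i _ => by
        simp only [Finset.coe_sdiff, Set.mem_sdiff, Finset.mem_coe, ← hl, hseg]
        omega)
    rcases lt_or_gt_of_ne hij with h' | h'
    · exact ⟨(i, j), h', h⟩
    · exact ⟨(j, i), h', h.symm⟩
  obtain ⟨⟨i, j⟩, hpair⟩ : ∃ p : Fin (c + 1) × Fin (c + 1), ∃ᶠ n in atTop, p.1 < p.2 ∧
      (x p.1)⁻¹ * x (p.1 + (n + 1)) = (x p.2)⁻¹ * x (p.2 + (n + 1)) := by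
    by_contra hcon
    simp only [not_exists, Filter.not_frequently] at hcon
    exact hpair ((Filter.eventually_all.2 hcon).mono fun n hn ⟨p, hp⟩ => hn p hp)
  simp only at hpair
  have hij : i < j := hpair.exists.choose_spec.1
  -- the Busemann function of the ray
  have hb : ∀ y, ∃ b : ℤ, ∀ᶠ m in atTop, (l (y⁻¹ * x m) : ℤ) - m = b := by
    intro y
    have hanti : Antitone fun m : ℕ => (l (y⁻¹ * x m) : ℤ) - m := by
      refine antitone_nat_of_succ_le fun m => ?_
      have h2 := hmul (y⁻¹ * x m) ((x m)⁻¹ * x (m + 1))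
      have h3 := hseg m 1
      rw [mul_assoc, mul_inv_cancel_left] at h2
      push_cast
      omega
    have hbdd : BddBelow (Set.range fun m : ℕ => (l (y⁻¹ * x m) : ℤ) - m) := by
      refine ⟨-(l y : ℤ), ?_⟩
      rintro _ ⟨m, rfl⟩
      have h2 := hmul y (y⁻¹ * x m)
      rw [mul_inv_cancel_left, hx] at h2
      simp only
      omega
    have hlim := tendsto_atTop_ciInf hanti hbdd
    rw [nhds_discrete, tendsto_pure] at hlim
    exact ⟨_, hlim⟩
  choose b hb using hb
  have hz : ∀ y, b (x j * (x i)⁻¹ * y) = b y - (j - i : ℕ) := by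
    intro y
    have e1 := (tendsto_add_atTop_nat (i + 1 : ℕ)).eventually (hb y)
    have e2 := (tendsto_add_atTop_nat (j + 1 : ℕ)).eventually (hb (x j * (x i)⁻¹ * y))
    obtain ⟨n, ⟨-, h⟩, h1, h2⟩ := (hpair.and_eventually (e1.and e2)).exists
    have hn1 : n + (i + 1 : ℕ) = i + (n + 1) := by ring
    have hn2 : n + (j + 1 : ℕ) = j + (n + 1) := by ring
    rw [hn1] at h1
    rw [hn2] at h2
    have : (x j * (x i)⁻¹ * y)⁻¹ * x (j + (n + 1)) = y⁻¹ * x (i + (n + 1)) := by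
      have : x (j + (n + 1)) = x j * ((x i)⁻¹ * x (i + (n + 1))) := by rw [h]; group
      rw [this]
      group
    rw [this] at h2
    have hij' : (i : ℕ) ≤ j := hij.le
    push_cast at h1 h2 ⊢
    omega
  refine ⟨x j * (x i)⁻¹, fun k hk => ?_⟩
  have hpow : ∀ k : ℕ, b ((x j * (x i)⁻¹) ^ k) = b 1 - k * (j - i : ℕ) := by
    intro k
    induction k with
    | zero => simp
    | succ k ih =>
      rw [pow_succ', hz, ih]
      push_cast
      ring
  have := hpow k
  rw [hk] at this
  have hij' : (0 : ℤ) < (j - i : ℕ) := by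
    have : (i : ℕ) < j := hij
    omega
  have h0 : (k : ℤ) * (j - i : ℕ) = 0 := by linarith
  rcases mul_eq_zero.1 h0 with h | h
  · exact_mod_cast h
  · omega

lemma frequently_card_sphere_le (h1 : 1 ∈ T) {K : ℕ} (hK : ∀ r, #(T ^ r) < K * (2 * r + 1)) :
    ∃ᶠ n in atTop, #(T ^ (n + 1) \ T ^ n) ≤ 2 * K := by
  by_contra hcon
  rw [Filter.not_frequently, eventually_atTop] at hcon
  obtain ⟨n₀, hn₀⟩ := hcon
  have hgrow : ∀ m, m * (2 * K + 1) ≤ #(T ^ (n₀ + m)) := by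
    intro m
    induction m with
    | zero => simp
    | succ m ih =>
      have h2 := hn₀ (n₀ + m) (by omega)
      rw [Finset.card_sdiff_of_subset (Finset.pow_subset_pow_right h1 (by omega))] at h2
      have h3 : (m + 1) * (2 * K + 1) = m * (2 * K + 1) + (2 * K + 1) := by ring
      rw [← add_assoc]
      omega
  have h2 := hgrow (K * (2 * n₀ + 1))
  have h3 := hK (n₀ + K * (2 * n₀ + 1))
  nlinarith

/-- In a group of linear growth, an element of infinite order generates a subgroup of finite
index. -/
lemma finiteIndex_zpowers_of_linear_growth (h1 : 1 ∈ T) (hs : T⁻¹ = T)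
    (hcl : Subgroup.closure (T : Set G) = ⊤) {K : ℕ} (hK : ∀ r, #(T ^ r) < K * (2 * r + 1))
    {z : G} (hz : ∀ k : ℕ, z ^ k = 1 → k = 0) : (Subgroup.zpowers z).FiniteIndex := by
  rw [Subgroup.finiteIndex_iff_finite_quotient]
  by_contra hinf
  rw [not_finite_iff_infinite] at hinf
  obtain ⟨b, hb⟩ := exists_mem_pow hs hcl z
  obtain ⟨A, hA⟩ := Infinite.exists_subset_card_eq (G ⧸ Subgroup.zpowers z) (2 * K * b + 1)
  obtain ⟨a, ha⟩ := exists_finset_subset_pow h1 hs hcl (A.image Quotient.out)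
  set n := K * (2 * a + 1)
  have hinj : Function.Injective fun k : ℕ => z ^ k :=
    injective_pow_iff_not_isOfFinOrder.2 fun h => by
      obtain ⟨k, hk, hk'⟩ := isOfFinOrder_iff_pow_eq_one.1 h
      exact hk.ne' (hz k hk')
  have hcard := Finset.card_le_card_of_injOn (s := A ×ˢ Finset.range (n + 1))
    (t := T ^ (a + n * b)) (fun p => p.1.out * z ^ p.2)
    (by
      rintro ⟨q, k⟩ hp
      simp only [Finset.coe_product, Set.mem_prod, Finset.mem_coe, Finset.mem_range] at hp
      simp only [Finset.mem_coe]
      rw [pow_add]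
      refine Finset.mul_mem_mul (ha (Finset.mem_image_of_mem _ hp.1)) ?_
      refine Finset.pow_subset_pow_right h1 (m := b * k) (by nlinarith) ?_
      rw [pow_mul]
      exact Finset.pow_mem_pow hb)
    (by
      rintro ⟨q, k⟩ - ⟨q', k'⟩ - h
      simp only at h
      have hq : q = q' := by
        rw [← QuotientGroup.out_eq' q, ← QuotientGroup.out_eq' q', QuotientGroup.eq]
        refine ⟨k - k', ?_⟩
        simp only [zpow_sub, zpow_natCast]
        rw [eq_inv_mul_iff_mul_eq, ← mul_assoc, h, mul_assoc, mul_inv_cancel, mul_one]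
      subst hq
      rw [mul_right_inj] at h
      rw [hinj h])
  rw [Finset.card_product, Finset.card_range, hA] at hcard
  have := hK (a + n * b)
  have hn : n = K * (2 * a + 1) := rfl
  nlinarith

/-- A finitely generated infinite group with no finite-index normal subgroup isomorphic to `ℤ` has
superlinear growth. -/
lemma exists_le_card_pow [Infinite G] (h1 : 1 ∈ T) (hs : T⁻¹ = T)
    (hcl : Subgroup.closure (T : Set G) = ⊤)
    (hZ : ∀ N : Subgroup G, N.Normal → N.FiniteIndex → IsEmpty (N ≃* Multiplicative ℤ)) (K : ℕ) :
    ∃ r, K * (2 * r + 1) ≤ #(T ^ r) := by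
  by_contra! hK
  obtain ⟨z, hz⟩ := exists_pow_ne_one_of_card_sphere_le h1 hs hcl (frequently_card_sphere_le h1 hK)
  have hfi := finiteIndex_zpowers_of_linear_growth h1 hs hcl hK hz
  set N := (Subgroup.zpowers z).normalCore
  have hN : N ≤ Subgroup.zpowers z := Subgroup.normalCore_le _
  have hNfi : N.FiniteIndex := Subgroup.finiteIndex_normalCore _
  have hcyc : IsCyclic N := Subgroup.isCyclic_of_le hN
  have hinf : Infinite N := by
    by_contra hfin
    rw [not_infinite_iff_finite] at hfin
    exact not_finite_iff_infinite.2 ‹Infinite G› (Finite.of_subgroup_quotient N)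
  exact (hZ N (Subgroup.normalCore_normal _) hNfi).false (intCyclicMulEquiv (G := N)).symm

end Growth

section Isoperimetry

variable {Q : Type*} [Group Q] [DecidableEq Q] {T A : Finset Q} {C : ℕ}

lemma card_filter_mul_notMem_le (hT : ∀ t ∈ T, #{a ∈ A | a * t ∉ A} ≤ C) (r : ℕ) :
    ∀ q ∈ T ^ r, #{a ∈ A | a * q ∉ A} ≤ r * C := by
  induction r with
  | zero =>
    intro q hq
    obtain rfl : q = 1 := by simpa using hq
    simp
  | succ r ih =>
    intro q hq
    rw [pow_succ] at hq
    obtain ⟨q, hqr, t, ht, rfl⟩ := Finset.mem_mul.1 hq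
    have hsub : {a ∈ A | a * (q * t) ∉ A} ⊆
        {a ∈ A | a * q ∉ A} ∪ ({a ∈ A | a * t ∉ A}.image fun a => a * q⁻¹) := by
      intro a ha
      rw [Finset.mem_filter] at ha
      by_cases h : a * q ∈ A
      · refine Finset.mem_union_right _ (Finset.mem_image.2 ⟨a * q, ?_, by simp⟩)
        rw [Finset.mem_filter, mul_assoc]
        exact ⟨h, ha.2⟩
      · exact Finset.mem_union_left _ (Finset.mem_filter.2 ⟨ha.1, h⟩)
    calc _ ≤ _ := Finset.card_le_card hsub
      _ ≤ _ := Finset.card_union_le _ _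
      _ ≤ r * C + C := add_le_add (ih q hqr) (Finset.card_image_le.trans (hT t ht))
      _ = _ := by ring

lemma card_le_of_two_mul_card_le_card_pow (hT : ∀ t ∈ T, #{a ∈ A | a * t ∉ A} ≤ C) {r : ℕ}
    (hr : 2 * #A ≤ #(T ^ r)) : #A ≤ 2 * (r * C) := by
  rcases A.eq_empty_or_nonempty with rfl | hA
  · simp
  have hpos : 0 < #(T ^ r) := by have := hA.card_pos; omega
  have h1 : ∑ a ∈ A, #{q ∈ T ^ r | a * q ∉ A} = ∑ q ∈ T ^ r, #{a ∈ A | a * q ∉ A} := by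
    simp only [Finset.card_filter]
    exact Finset.sum_comm
  have h2 : ∀ a ∈ A, #(T ^ r) - #A ≤ #{q ∈ T ^ r | a * q ∉ A} := by
    intro a _
    have h3 := Finset.card_filter_add_card_filter_not (s := T ^ r) (fun q => a * q ∈ A)
    have h4 : #{q ∈ T ^ r | a * q ∈ A} ≤ #A :=
      Finset.card_le_card_of_injOn (fun q => a * q) (fun q hq => (Finset.mem_filter.1 hq).2)
        fun x _ y _ h => mul_left_cancel h
    omega
  have h3 := Finset.card_nsmul_le_sum A _ _ h2
  have h4 := Finset.sum_le_card_nsmul (T ^ r) _ _ (card_filter_mul_notMem_le hT r)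
  rw [h1] at h3
  have h5 := h3.trans h4
  simp only [smul_eq_mul] at h5
  have h6 : #(T ^ r) ≤ 2 * (#(T ^ r) - #A) := by omega
  have h7 : #(T ^ r) * #A ≤ #(T ^ r) * (2 * (r * C)) := by
    calc #(T ^ r) * #A ≤ (2 * (#(T ^ r) - #A)) * #A := Nat.mul_le_mul_right _ h6
      _ = 2 * (#A * (#(T ^ r) - #A)) := by ring
      _ ≤ 2 * (#(T ^ r) * (r * C)) := Nat.mul_le_mul_left _ h5
      _ = _ := by ring
  exact Nat.le_of_mul_le_mul_left h7 hpos

/-- Sets with small boundary in a finite group containing a large ball are small or cosmall. -/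
lemma card_le_of_card_boundary_le [Fintype Q] (h1 : 1 ∈ T) (hs : T⁻¹ = T)
    (hcl : Subgroup.closure (T : Set Q) = ⊤) {r : ℕ}
    (hr : 8 * (C + 1) * (2 * r + 1) ≤ #(T ^ r))
    (hT : ∀ t ∈ T, #{a ∈ A | a * t ∉ A} ≤ C) (hA : 2 * #A ≤ Fintype.card Q) :
    #A ≤ 4 * ((2 * r + 1) * C) := by
  set m := #(T ^ r) with hm
  have hm0 : 0 < m := lt_of_lt_of_le (by positivity) hr
  set j := 2 * #A / m with hj
  have hjm : 2 * #A ≤ (j + 1) * m := by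
    rw [hj, mul_comm (_ + 1)]
    exact (Nat.lt_mul_div_succ _ hm0).le
  have hjm' : j * m ≤ 2 * #A := Nat.div_mul_le_self _ _
  have hgrow := min_card_le_card_pow h1 hs hcl hm.le (j + 1)
  have hle := card_le_of_two_mul_card_le_card_pow hT ((le_min hA hjm).trans hgrow)
  have : j * (8 * ((2 * r + 1) * C)) ≤ j * m := by
    apply Nat.mul_le_mul_left
    nlinarith
  nlinarith

end Isoperimetry

/-- The data of a symmetric finitely supported Laplacian: `F` is a finite symmetric generating set
containing `1` and the support of `f`. -/
structure LaplacianData {G : Type*} [Group G] [DecidableEq G] (f : G → ℤ) (F : Finset G) :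
    Prop where
  one_mem : 1 ∈ F
  inv_eq : F⁻¹ = F
  closure_eq : Subgroup.closure (F : Set G) = ⊤
  symm : ∀ s, f s⁻¹ = f s
  sum_eq_zero : ∑ s ∈ F, f s = 0
  le_neg_one : ∀ s ∈ F, s ≠ 1 → f s ≤ -1
  eq_zero : ∀ s ∉ F, f s = 0

/-- The Laplacian of `f` acting on functions on a quotient `π : G →* Q`. -/
def lap {G Q M : Type*} [Group G] [Group Q] [AddCommGroup M] (f : G → ℤ) (F : Finset G)
    (π : G →* Q) (v : Q → M) (q : Q) : M :=
  ∑ s ∈ F, f s • v (q * π s)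

lemma lap_neg {G Q : Type*} [Group G] [Group Q] {f : G → ℤ} {F : Finset G} {π : G →* Q}
    (v : Q → ℤ) (q : Q) :
    lap f F π (fun q => -v q) q = -lap f F π v q := by
  simp [lap]

section Laplacian

variable {G Q : Type*} [Group G] [DecidableEq G] [Group Q] {f : G → ℤ} {F : Finset G}
  {π : G →* Q}

lemma LaplacianData.inv_mem (h : LaplacianData f F) {s : G} : s⁻¹ ∈ F ↔ s ∈ F := by
  rw [← Finset.mem_inv', h.inv_eq]

lemma LaplacianData.sum_inv {M : Type*} [AddCommMonoid M] (h : LaplacianData f F) (φ : G → M) :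
    ∑ s ∈ F, φ s⁻¹ = ∑ s ∈ F, φ s :=
  Finset.sum_bij' (fun s _ => s⁻¹) (fun s _ => s⁻¹) (fun _ hs => h.inv_mem.2 hs)
    (fun _ hs => h.inv_mem.2 hs) (by simp) (by simp) (by simp)

lemma lap_sub_const (h : LaplacianData f F) (v : Q → ℤ) (c : ℤ) (q : Q) :
    lap f F π (fun q => v q - c) q = lap f F π v q := by
  simp only [lap, smul_eq_mul, mul_sub, Finset.sum_sub_distrib, ← Finset.sum_mul,
    h.sum_eq_zero, zero_mul, sub_zero]

lemma LaplacianData.image_one_mem [DecidableEq Q] (h : LaplacianData f F) : 1 ∈ F.image π :=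
  Finset.mem_image.2 ⟨1, h.one_mem, map_one π⟩

lemma LaplacianData.image_inv_eq [DecidableEq Q] (h : LaplacianData f F) :
    (F.image π)⁻¹ = F.image π := by
  rw [← Finset.image_inv π, h.inv_eq]

lemma LaplacianData.image_closure_eq [DecidableEq Q] (h : LaplacianData f F)
    (hπ : Function.Surjective π) :
    Subgroup.closure (F.image π : Set Q) = ⊤ := by
  rw [Finset.coe_image, ← MonoidHom.map_closure, h.closure_eq, ← MonoidHom.range_eq_map,
    MonoidHom.range_eq_top.2 hπ]

variable [Fintype Q]

/-- Green's formula. -/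
lemma two_mul_sum_mul_lap (h : LaplacianData f F) (v w : Q → ℤ) :
    2 * ∑ q, w q * lap f F π v q =
      ∑ s ∈ F, ∑ q, -f s * ((v q - v (q * π s)) * (w q - w (q * π s))) := by
  have e1 : ∑ q, w q * lap f F π v q =
      ∑ s ∈ F, ∑ q, -f s * ((v q - v (q * π s)) * w q) := by
    rw [Finset.sum_comm]
    refine Finset.sum_congr rfl fun q _ => ?_
    have : ∀ s, -f s * ((v q - v (q * π s)) * w q) = w q * (f s * v (q * π s)) -
        f s * (v q * w q) := fun s => by ring
    simp only [this, Finset.sum_sub_distrib, ← Finset.sum_mul, h.sum_eq_zero, zero_mul, sub_zero,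
      ← Finset.mul_sum]
    simp [lap]
  have e2 : ∑ s ∈ F, ∑ q, -f s * ((v q - v (q * π s)) * w q) =
      ∑ s ∈ F, ∑ q, -f s * ((v (q * π s) - v q) * w (q * π s)) := by
    rw [← h.sum_inv]
    refine Finset.sum_congr rfl fun s _ => ?_
    rw [← Equiv.sum_comp (Equiv.mulRight (π s))]
    refine Finset.sum_congr rfl fun q _ => ?_
    simp [h.symm]
  rw [two_mul]
  nth_rw 2 [e1]
  rw [e1, e2]
  nth_rw 1 [← e2]
  rw [← Finset.sum_add_distrib]
  refine Finset.sum_congr rfl fun s _ => ?_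
  rw [← Finset.sum_add_distrib]
  refine Finset.sum_congr rfl fun q _ => ?_
  ring

variable [DecidableEq Q]

/-- Level sets of an integer-valued function have boundary controlled by its Laplacian. -/
lemma card_boundary_level_le (h : LaplacianData f F) (v : Q → ℤ) (k : ℤ) {C : ℕ}
    (hC : 2 * ∑ q, |lap f F π v q| ≤ C) :
    ∀ t ∈ F.image π,
      #{a ∈ ({q | k ≤ v q} : Finset Q) | a * t ∉ ({q | k ≤ v q} : Finset Q)} ≤ C := by
  intro t ht
  obtain ⟨t, htF, rfl⟩ := Finset.mem_image.1 ht
  let w : Q → ℤ := fun q => if k ≤ v q then 1 else 0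
  have hterm : ∀ s ∈ F, ∀ q, (if k ≤ v q ∧ v (q * π s) < k then 1 else 0) ≤
      -f s * ((v q - v (q * π s)) * (w q - w (q * π s))) := by
    intro s hs q
    by_cases hs1 : s = 1
    · subst hs1
      have hnot : ¬(k ≤ v q ∧ v q < k) := by omega
      simp [hnot]
    · have hfs := h.le_neg_one s hs hs1
      simp only [w]
      split_ifs <;> first | omega | nlinarith
  have hle : (#{a ∈ ({q | k ≤ v q} : Finset Q) | a * π t ∉ ({q | k ≤ v q} : Finset Q)} : ℤ) ≤
      2 * ∑ q, w q * lap f F π v q := by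
    rw [two_mul_sum_mul_lap h]
    calc _ = ∑ q, (if k ≤ v q ∧ v (q * π t) < k then (1 : ℤ) else 0) := by
          rw [Finset.filter_filter, Finset.card_filter]
          push_cast
          refine Finset.sum_congr rfl fun q _ => ?_
          simp
      _ ≤ ∑ q, -f t * ((v q - v (q * π t)) * (w q - w (q * π t))) :=
          Finset.sum_le_sum fun q _ => hterm t htF q
      _ ≤ _ := Finset.single_le_sum
          (f := fun s => ∑ q, -f s * ((v q - v (q * π s)) * (w q - w (q * π s))))
          (fun s hs => Finset.sum_nonneg fun q _ =>
            le_trans (by split_ifs <;> simp) (hterm s hs q)) htF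
  have hle2 : ∑ q, w q * lap f F π v q ≤ ∑ q, |lap f F π v q| := by
    refine Finset.sum_le_sum fun q _ => ?_
    simp only [w]
    split_ifs
    · simpa using le_abs_self _
    · simp
  have := hle.trans ((mul_le_mul_of_nonneg_left hle2 (by norm_num)).trans hC)
  exact_mod_cast this

/-- An integer-valued function with small Laplacian is constant off a set of bounded size. -/
lemma exists_card_ne_le (h : LaplacianData f F) (hπ : Function.Surjective π) {r C : ℕ}
    (hr : 8 * (C + 1) * (2 * r + 1) ≤ #((F.image π) ^ r)) (v : Q → ℤ)
    (hC : 2 * ∑ q, |lap f F π v q| ≤ C) :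
    ∃ c, #{q | v q ≠ c} ≤ 8 * ((2 * r + 1) * C) := by
  have hup : ∀ (v : Q → ℤ), 2 * ∑ q, |lap f F π v q| ≤ C → ∀ k : ℤ,
      2 * #{q | k ≤ v q} ≤ Fintype.card Q → #{q | k ≤ v q} ≤ 4 * ((2 * r + 1) * C) :=
    fun v hv k hk => card_le_of_card_boundary_le h.image_one_mem h.image_inv_eq
      (h.image_closure_eq hπ) hr (card_boundary_level_le h v k hv) hk
  have hdown : ∀ k : ℤ, 2 * #{q | v q < k} ≤ Fintype.card Q →
      #{q | v q < k} ≤ 4 * ((2 * r + 1) * C) := by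
    intro k hk
    have hset : Finset.univ.filter (fun q => v q < k) =
        Finset.univ.filter fun q => -k + 1 ≤ -v q := by
      ext q
      simp only [Finset.mem_filter, Finset.mem_univ, true_and]
      omega
    rw [hset] at hk ⊢
    exact hup (fun q => -v q) (by simpa only [lap_neg, abs_neg] using hC) _ hk
  obtain ⟨c, hc, hmax⟩ : ∃ c : ℤ, 2 * #{q | v q < c} ≤ Fintype.card Q ∧
      ∀ k : ℤ, 2 * #{q | v q < k} ≤ Fintype.card Q → k ≤ c := by
    refine Int.exists_greatest_of_bdd ⟨∑ q, |v q|, fun k hk => ?_⟩ ⟨-∑ q, |v q|, ?_⟩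
    · by_contra! hlt
      have : Finset.univ.filter (fun q => v q < k) = Finset.univ := by
        ext q
        simp only [Finset.mem_filter, Finset.mem_univ, true_and, iff_true]
        exact lt_of_le_of_lt ((le_abs_self _).trans (Finset.single_le_sum
          (f := fun q => |v q|) (fun _ _ => abs_nonneg _) (Finset.mem_univ q))) hlt
      rw [this, Finset.card_univ] at hk
      have := Fintype.card_pos (α := Q)
      omega
    · have : Finset.univ.filter (fun q => v q < -∑ q, |v q|) = ∅ := by
        ext q
        simp only [Finset.mem_filter, Finset.mem_univ, true_and, Finset.notMem_empty, iff_false,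
          not_lt]
        have h2 := Finset.single_le_sum (f := fun q => |v q|) (fun _ _ => abs_nonneg _)
          (Finset.mem_univ q)
        have h3 := neg_abs_le (v q)
        linarith
      simp [this]
  refine ⟨c, ?_⟩
  have h1 := hdown c hc
  have h2 : #{q | c + 1 ≤ v q} ≤ 4 * ((2 * r + 1) * C) := by
    apply hup v hC
    have h3 : ¬ 2 * #{q | v q < c + 1} ≤ Fintype.card Q := fun h => by
      have := hmax _ h
      omega
    have h4 := Finset.card_filter_add_card_filter_not (s := (Finset.univ : Finset Q))
      (fun q => v q < c + 1)
    simp only [not_lt, Finset.card_univ] at h4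
    omega
  have hsub : Finset.univ.filter (fun q => v q ≠ c) ⊆
      Finset.univ.filter (fun q => v q < c) ∪ Finset.univ.filter fun q => c + 1 ≤ v q := by
    intro q
    simp only [Finset.mem_filter, Finset.mem_univ, true_and, Finset.mem_union]
    omega
  have := (Finset.card_le_card hsub).trans (Finset.card_union_le _ _)
  omega

end Laplacian

/-- A potential with small support can be cut off along an annulus on which it vanishes. -/
lemma exists_local_potential {G Q : Type*} [Group G] [Group Q] [Fintype Q] [DecidableEq Q]
    {f : G → ℤ} {F : Finset G} {π : G →* Q} {g' v : Q → ℤ} {a M : ℕ}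
    (h1 : 1 ∈ F.image π) (hinv : (F.image π)⁻¹ = F.image π)
    (hg' : ∀ q, g' q ≠ 0 → q ∈ (F.image π) ^ a) (hM : #{q | v q ≠ 0} ≤ M)
    (hv : ∀ q ∈ (F.image π) ^ (a + 2 * M + 1), lap f F π v q = g' q) :
    ∃ v' : Q → ℤ, (∀ q, v' q ≠ 0 → q ∈ (F.image π) ^ (a + 2 * M)) ∧
      ∀ q, lap f F π v' q = g' q := by
  set T := F.image π
  have hmono : ∀ {m n : ℕ}, m ≤ n → T ^ m ⊆ T ^ n := fun h => Finset.pow_subset_pow_right h1 h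
  obtain ⟨i, hi, hann⟩ : ∃ i ≤ M, ∀ q ∈ T ^ (a + 2 * i + 2), q ∉ T ^ (a + 2 * i) → v q = 0 := by
    by_contra! hcon
    choose! y hy hy' hvy using hcon
    have hlt : ∀ i ≤ M, ∀ j ≤ M, i < j → y i ≠ y j := fun i hi j hj hij heq =>
      hy' j hj (heq ▸ hmono (by omega) (hy i hi))
    have := Finset.card_le_card_of_injOn (s := Finset.range (M + 1)) (t := {q | v q ≠ 0}) y
      (fun i hi => by simpa using hvy i (by simpa [Nat.lt_succ_iff] using hi))
      (fun i hi j hj heq => by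
        simp only [Finset.coe_range, Set.mem_Iio, Nat.lt_succ_iff] at hi hj
        by_contra hne
        rcases lt_or_gt_of_ne hne with hlt' | hlt'
        · exact hlt i hi j hj hlt' heq
        · exact hlt j hj i hi hlt' heq.symm)
    rw [Finset.card_range] at this
    omega
  set b := a + 2 * i
  refine ⟨fun q => if q ∈ T ^ b then v q else 0, fun q hq => ?_, fun q => ?_⟩
  · simp only [ne_eq, ite_eq_right_iff, Classical.not_imp] at hq
    exact hmono (by omega) hq.1
  · by_cases hq : q ∈ T ^ (b + 1)
    · rw [← hv q (hmono (by omega) hq)]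
      refine Finset.sum_congr rfl fun s hs => ?_
      have hqs : q * π s ∈ T ^ (b + 2) := by
        rw [pow_succ]
        exact Finset.mul_mem_mul hq (Finset.mem_image_of_mem _ hs)
      by_cases hqs' : q * π s ∈ T ^ b
      · simp [hqs']
      · simp [hqs', hann _ hqs hqs']
    · have hgq : g' q = 0 := by
        by_contra hne
        exact hq (hmono (by omega) (hg' q hne))
      rw [hgq]
      refine Finset.sum_eq_zero fun s hs => ?_
      have hqs' : q * π s ∉ T ^ b := by
        intro hmem
        apply hq
        have := Finset.mul_mem_mul hmem (s := T ^ b) (t := T)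
          (b := (π s)⁻¹) (by
            rw [← hinv, Finset.mem_inv', inv_inv]
            exact Finset.mem_image_of_mem π hs)
        rwa [mul_inv_cancel_right, ← pow_succ] at this
      simp [hqs']

/-- If `g` is not a multiple of `f`, then an element of a large finite quotient that fixes the
class of `g` modulo `f` lies in a ball of bounded radius. -/
lemma exists_mem_image_pow_of_lap_eq {G : Type*} [Group G] [DecidableEq G] [Infinite G]
    {f : G → ℤ} {F : Finset G} (h : LaplacianData f F)
    (hZ : ∀ N : Subgroup G, N.Normal → N.FiniteIndex → IsEmpty (N ≃* Multiplicative ℤ))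
    (g : G →₀ ℤ) (hg : ¬∃ v : G →₀ ℤ, ∀ w, lap f F (MonoidHom.id G) v w = g w) :
    ∃ D m : ℕ, ∀ {Q : Type*} [Group Q] [Fintype Q] [DecidableEq Q] (π : G →* Q),
      Function.Surjective π → Set.InjOn π (F ^ m : Finset G) → ∀ (y : Q) (v : Q → ℤ),
      (∀ q, lap f F π v q = g.mapDomain π q - g.mapDomain π (y⁻¹ * q)) →
      y ∈ (F ^ D).image π := by
  obtain ⟨a, ha⟩ := exists_finset_subset_pow h.one_mem h.inv_eq h.closure_eq g.support
  set C : ℕ := 4 * ∑ t ∈ g.support, (g t).natAbs with hCdef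
  obtain ⟨r, hr⟩ := exists_le_card_pow h.one_mem h.inv_eq h.closure_eq hZ (8 * (C + 1))
  set M := 8 * ((2 * r + 1) * C)
  refine ⟨a + 2 * M + 1 + a, a + 2 * M + 2 + r, ?_⟩
  intro Q _ _ _ π hπ hinj y v hv
  by_contra hy
  have himage : ∀ n : ℕ, (F.image π) ^ n = (F ^ n).image π := fun n =>
    (Finset.image_pow π F n).symm
  have hmono : ∀ {m n : ℕ}, m ≤ n → F ^ m ⊆ F ^ n :=
    fun h' => Finset.pow_subset_pow_right h.one_mem h'
  have hsupp : ∀ q, g.mapDomain π q ≠ 0 → q ∈ (F.image π) ^ a := by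
    intro q hq
    have := Finsupp.mapDomain_support (Finsupp.mem_support_iff.2 hq)
    rw [himage]
    exact Finset.image_subset_image ha this
  have hnorm : ∑ q, |g.mapDomain π q| ≤ ∑ t ∈ g.support, |g t| := by
    simp only [Finsupp.mapDomain, Finsupp.sum, Finsupp.finsetSum_apply]
    refine (Finset.sum_le_sum fun q _ => Finset.abs_sum_le_sum_abs _ _).trans ?_
    rw [Finset.sum_comm]
    refine Finset.sum_le_sum fun t _ => ?_
    simp [Finsupp.single_apply, apply_ite abs]
  have hC : 2 * ∑ q, |lap f F π v q| ≤ C := by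
    have e1 : ∑ q, |lap f F π v q| ≤
        ∑ q, |g.mapDomain π q| + ∑ q, |g.mapDomain π (y⁻¹ * q)| := by
      rw [← Finset.sum_add_distrib]
      refine Finset.sum_le_sum fun q _ => ?_
      rw [hv]
      exact abs_sub _ _
    have e2 : ∑ q, |g.mapDomain π (y⁻¹ * q)| = ∑ q, |g.mapDomain π q| :=
      Equiv.sum_comp (Equiv.mulLeft y⁻¹) fun q => |g.mapDomain π q|
    rw [hCdef]
    push_cast
    linarith
  have hr' : 8 * (C + 1) * (2 * r + 1) ≤ #((F.image π) ^ r) := by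
    rw [himage, Finset.card_image_of_injOn (hinj.mono (by exact_mod_cast hmono (by omega)))]
    exact hr
  obtain ⟨c, hc⟩ := exists_card_ne_le h hπ hr' v hC
  have hM : #{q | v q - c ≠ 0} ≤ M := by simpa only [ne_eq, sub_eq_zero] using hc
  obtain ⟨v', hv', hlap⟩ := exists_local_potential (f := f) (g' := g.mapDomain π)
    h.image_one_mem h.image_inv_eq hsupp hM fun q hq => by
      rw [lap_sub_const h, hv, sub_eq_self]
      by_contra hne
      apply hy
      have h2 := Finset.mul_mem_mul hq (inv_mem_pow h.image_inv_eq (hsupp _ hne))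
      rw [← pow_add, himage] at h2
      simpa using h2
  set b := a + 2 * M with hb
  have hinj' : ∀ s ∈ F ^ (b + 2), ∀ t ∈ F ^ (b + 2), π s = π t → s = t := fun s hs t ht hst =>
    hinj (hmono (by omega) hs) (hmono (by omega) ht) hst
  refine hg ⟨Finsupp.onFinset (F ^ b) (fun t => if t ∈ F ^ b then v' (π t) else 0)
    (fun t ht => by by_contra hne; simp [hne] at ht),
    fun w => ?_⟩
  have hstep : ∀ {n : ℕ} {w s : G}, w ∈ F ^ n → s ∈ F → w * s ∈ F ^ (n + 1) := fun hw hs => by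
    rw [pow_succ]
    exact Finset.mul_mem_mul hw hs
  by_cases hw : w ∈ F ^ (b + 1)
  · have hgw : g.mapDomain π (π w) = g w := by
      simp only [Finsupp.mapDomain, Finsupp.sum, Finsupp.finsetSum_apply,
        Finsupp.single_apply]
      rw [Finset.sum_eq_single w]
      · simp
      · intro t ht htw
        rw [if_neg]
        exact fun hst => htw (hinj' _ (hmono (by omega) (ha ht)) _ (hmono (by omega) hw) hst)
      · intro hw0
        simpa using hw0
    rw [← hgw, ← hlap]
    refine Finset.sum_congr rfl fun s hs => ?_
    by_cases hws : w * s ∈ F ^ b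
    · simp [hws]
    · suffices v' (π w * π s) = 0 by simp [hws, this]
      by_contra hne
      have h2 := hv' _ hne
      rw [himage, ← map_mul] at h2
      obtain ⟨t, ht, hts⟩ := Finset.mem_image.1 h2
      exact hws (hinj' t (hmono (by omega) ht) _ (hstep hw hs) hts ▸ ht)
  · have hgw : g w = 0 := by
      by_contra hne
      exact hw (hmono (by omega) (ha (Finsupp.mem_support_iff.2 hne)))
    rw [hgw]
    refine Finset.sum_eq_zero fun s hs => ?_
    have hws : w * s ∉ F ^ b := fun hmem => hw (by
      simpa using hstep hmem (h.inv_mem.2 hs))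
    simp [hws]

/-- The pairing of a finitely supported integer-valued function with a circle-valued one. -/
noncomputable def circlePairing {Q : Type*} (x : Q → UnitAddCircle) : (Q →₀ ℤ) →+ UnitAddCircle :=
  Finsupp.liftAddHom fun q => zmultiplesHom _ (x q)

lemma circlePairing_single {Q : Type*} (x : Q → UnitAddCircle) (q : Q) (n : ℤ) :
    circlePairing x (Finsupp.single q n) = n • x q := by
  simp [circlePairing]

lemma circlePairing_mapDomain {P Q : Type*} (x : Q → UnitAddCircle) (φ : P → Q) (g : P →₀ ℤ) :
    circlePairing x (g.mapDomain φ) = circlePairing (fun p => x (φ p)) g := by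
  induction g using Finsupp.induction_linear with
  | zero => simp
  | add g g' hg hg' => rw [Finsupp.mapDomain_add, map_add, map_add, hg, hg']
  | single p n => rw [Finsupp.mapDomain_single, circlePairing_single, circlePairing_single]

/-- The Laplacian of `f` acting on finitely supported functions. -/
noncomputable def lapHom {G Q : Type*} [Group G] [Group Q] (f : G → ℤ) (F : Finset G)
    (π : G →* Q) : (Q →₀ ℤ) →+ (Q →₀ ℤ) :=
  Finsupp.liftAddHom fun q => zmultiplesHom _ (∑ s ∈ F, Finsupp.single (q * π s) (f s))

section Duality

variable {G Q : Type*} [Group G] [Group Q] {f : G → ℤ} {F : Finset G} (π : G →* Q)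

lemma lapHom_apply [DecidableEq G] (h : LaplacianData f F) (v : Q →₀ ℤ) (q : Q) :
    lapHom f F π v q = lap f F π v q := by
  classical
  induction v using Finsupp.induction_linear with
  | zero => simp [lap]
  | add v w hv hw =>
    rw [map_add, Finsupp.add_apply, hv, hw]
    simp [lap, mul_add, Finset.sum_add_distrib]
  | single p n =>
    simp only [lapHom, Finsupp.liftAddHom_apply_single, zmultiplesHom_apply, Finsupp.smul_apply,
      Finsupp.finsetSum_apply, lap, Finsupp.single_apply, smul_eq_mul]
    rw [← h.sum_inv, Finset.mul_sum]
    refine Finset.sum_congr rfl fun s _ => ?_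
    have : (p * π s⁻¹ = q) ↔ (p = q * π s) := by rw [map_inv, mul_inv_eq_iff_eq_mul]
    simp only [this, h.symm]
    split_ifs <;> ring

lemma circlePairing_lapHom_single (x : Q → UnitAddCircle) (q : Q) (n : ℤ) :
    circlePairing x (lapHom f F π (Finsupp.single q n)) = n • lap f F π x q := by
  simp only [lapHom, Finsupp.liftAddHom_apply_single, zmultiplesHom_apply, map_zsmul, map_sum,
    circlePairing_single, lap]

lemma circlePairing_lapHom_eq_zero {x : Q → UnitAddCircle} (hx : ∀ q, lap f F π x q = 0)
    (v : Q →₀ ℤ) : circlePairing x (lapHom f F π v) = 0 := by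
  induction v using Finsupp.induction_linear with
  | zero => simp
  | add v w hv hw => rw [map_add, map_add, hv, hw, add_zero]
  | single q n => rw [circlePairing_lapHom_single, hx, smul_zero]

/-- A finitely supported function pairing trivially with all harmonic circle-valued functions is a
Laplacian. -/
lemma exists_lapHom_eq_of_circlePairing_eq_zero (g : Q →₀ ℤ)
    (hg : ∀ x : Q → UnitAddCircle, (∀ q, lap f F π x q = 0) → circlePairing x g = 0) :
    ∃ v : Q →₀ ℤ, lapHom f F π v = g := by
  rw [← Set.mem_range, ← AddMonoidHom.coe_range, SetLike.mem_coe, ← QuotientAddGroup.eq_zero_iff]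
  refine CharacterModule.eq_zero_of_character_apply fun c => ?_
  let ι : AddCircle (1 : ℚ) →+ UnitAddCircle :=
    QuotientAddGroup.map _ _ (Rat.castHom ℝ).toAddMonoidHom (by
      rw [AddSubgroup.zmultiples_le]
      exact ⟨1, by simp⟩)
  have hι : Function.Injective ι := by
    rw [injective_iff_map_eq_zero]
    intro x hx
    induction x using QuotientAddGroup.induction_on with | _ x => ?_
    obtain ⟨n, hn⟩ := (QuotientAddGroup.eq_zero_iff _).1 hx
    refine (QuotientAddGroup.eq_zero_iff _).2 ⟨n, ?_⟩
    have : ((n : ℚ) : ℝ) = (x : ℝ) := by simpa using hn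
    simpa using Rat.cast_injective this
  apply hι
  rw [map_zero]
  let φ : (Q →₀ ℤ) →+ UnitAddCircle :=
    (ι.comp (c : _ →+ AddCircle (1 : ℚ))).comp (QuotientAddGroup.mk' (lapHom f F π).range)
  have hφ : circlePairing (fun q => φ (Finsupp.single q 1)) = φ := by
    refine Finsupp.addHom_ext fun q n => ?_
    rw [circlePairing_single, ← map_zsmul, Finsupp.smul_single, smul_eq_mul, mul_one]
  change φ g = 0
  rw [← hφ]
  refine hg _ fun q => ?_
  rw [← one_smul ℤ (lap f F π _ q), ← circlePairing_lapHom_single, hφ]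
  have : (QuotientAddGroup.mk' (lapHom f F π).range) (lapHom f F π (Finsupp.single q 1)) = 0 :=
    (QuotientAddGroup.eq_zero_iff _).2 ⟨_, rfl⟩
  simp only [φ, AddMonoidHom.comp_apply, this, map_zero]

end Duality

section Characters

variable {G : Type*}

/-- The character of `(ℝ/ℤ)^G` attached to a finitely supported integer-valued function. -/
noncomputable def torusChar (g : G →₀ ℤ) : C(G → UnitAddCircle, ℂ) where
  toFun x := AddCircle.toCircle (circlePairing x g)
  continuous_toFun := by
    refine continuous_subtype_val.comp (AddCircle.continuous_toCircle.comp ?_)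
    simp only [circlePairing, Finsupp.liftAddHom_apply, Finsupp.sum, zmultiplesHom_apply]
    fun_prop

lemma torusChar_apply (g : G →₀ ℤ) (x : G → UnitAddCircle) :
    torusChar g x = AddCircle.toCircle (circlePairing x g) := rfl

lemma torusChar_zero : torusChar (0 : G →₀ ℤ) = 1 := by
  ext x
  simp [torusChar_apply]

lemma torusChar_add (g g' : G →₀ ℤ) : torusChar (g + g') = torusChar g * torusChar g' := by
  ext x
  simp [torusChar_apply, AddCircle.toCircle_add]

lemma torusChar_neg (g : G →₀ ℤ) : torusChar (-g) = star (torusChar g) := by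
  ext x
  rw [torusChar_apply, map_neg, AddCircle.toCircle_neg, Circle.coe_inv_eq_conj]
  rfl

lemma norm_torusChar_apply (g : G →₀ ℤ) (x : G → UnitAddCircle) : ‖torusChar g x‖ = 1 :=
  Circle.norm_coe _

lemma circlePairing_add_left (x y : G → UnitAddCircle) (g : G →₀ ℤ) :
    circlePairing (x + y) g = circlePairing x g + circlePairing y g := by
  simp [circlePairing, Finsupp.sum, Finset.sum_add_distrib]

lemma torusChar_apply_add (g : G →₀ ℤ) (x y : G → UnitAddCircle) :
    torusChar g (x + y) = torusChar g x * torusChar g y := by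
  simp [torusChar_apply, circlePairing_add_left, AddCircle.toCircle_add]

lemma torusChar_apply_eq_one_iff {g : G →₀ ℤ} {x : G → UnitAddCircle} :
    torusChar g x = 1 ↔ circlePairing x g = 0 := by
  rw [torusChar_apply, Circle.coe_eq_one, ← AddCircle.toCircle_zero (T := 1),
    (AddCircle.injective_toCircle one_ne_zero).eq_iff]

lemma span_torusChar_closure_eq_top :
    (Submodule.span ℂ (Set.range (torusChar (G := G)))).topologicalClosure = ⊤ := by
  let A : StarSubalgebra ℂ C(G → UnitAddCircle, ℂ) :=
    { toSubalgebra := Algebra.adjoin ℂ (Set.range (torusChar (G := G)))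
      star_mem' := by
        change Algebra.adjoin ℂ (Set.range (torusChar (G := G))) ≤
          star (Algebra.adjoin ℂ (Set.range (torusChar (G := G))))
        refine Algebra.adjoin_le ?_
        rintro - ⟨g, rfl⟩
        exact Algebra.subset_adjoin ⟨-g, torusChar_neg g⟩ }
  have hA : Subalgebra.toSubmodule A.toSubalgebra =
      Submodule.span ℂ (Set.range (torusChar (G := G))) := by
    apply Algebra.adjoin_eq_span_of_subset
    refine Set.Subset.trans ?_ Submodule.subset_span
    intro x hx
    refine Submonoid.closure_induction (fun _ => id) ⟨0, torusChar_zero⟩ ?_ hx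
    rintro - - - - ⟨g, rfl⟩ ⟨g', rfl⟩
    exact ⟨g + g', torusChar_add g g'⟩
  have hsep : A.SeparatesPoints := by
    intro x y hxy
    obtain ⟨t, ht⟩ := Function.ne_iff.1 hxy
    refine ⟨_, ⟨torusChar (Finsupp.single t 1), Algebra.subset_adjoin ⟨_, rfl⟩, rfl⟩, ?_⟩
    dsimp only
    contrapose! ht
    rw [torusChar_apply, torusChar_apply, Circle.coe_inj,
      (AddCircle.injective_toCircle one_ne_zero).eq_iff, circlePairing_single,
      circlePairing_single, one_smul, one_smul] at ht
    exact ht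
  rw [← hA]
  exact congrArg (Subalgebra.toSubmodule <| StarSubalgebra.toSubalgebra ·)
    (ContinuousMap.starSubalgebra_topologicalClosure_eq_top_of_separatesPoints A hsep)

lemma integral_torusChar_eq_zero [Countable G] {μ : Measure (G → UnitAddCircle)} {g : G →₀ ℤ}
    {x : G → UnitAddCircle} (hμ : μ.map (fun y => y + x) = μ) (hx : circlePairing x g ≠ 0) :
    ∫ y, torusChar g y ∂μ = 0 := by
  have h : ∫ y, torusChar g y ∂μ = (∫ y, torusChar g y ∂μ) * torusChar g x := by
    conv_lhs => rw [← hμ]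
    rw [integral_map (by fun_prop) (torusChar g).continuous.aestronglyMeasurable,
      ← integral_mul_const]
    simp only [torusChar_apply_add]
  by_contra hne
  exact hx (torusChar_apply_eq_one_iff.1 (mul_left_cancel₀ hne (by rw [← h, mul_one])))

end Characters

section SecondMoment

variable {X : Type*} [TopologicalSpace X] [CompactSpace X] [MeasurableSpace X]
  [OpensMeasurableSpace X]

lemma ContinuousMap.integrable_norm_sq (μ : Measure X) [IsFiniteMeasure μ] (p : C(X, ℂ)) :
    Integrable (fun x => ‖p x‖ ^ 2) μ := by
  refine Integrable.of_bound (by fun_prop) (‖p‖ ^ 2) (.of_forall fun x => ?_)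
  rw [Real.norm_of_nonneg (by positivity)]
  gcongr
  exact p.norm_coe_le_norm x

lemma integral_norm_sq_add_le (μ : Measure X) [IsFiniteMeasure μ] (p q : C(X, ℂ)) :
    ∫ x, ‖(p + q) x‖ ^ 2 ∂μ ≤ 2 * ∫ x, ‖p x‖ ^ 2 ∂μ + 2 * ∫ x, ‖q x‖ ^ 2 ∂μ := by
  rw [← integral_const_mul, ← integral_const_mul,
    ← integral_add ((p.integrable_norm_sq μ).const_mul 2) ((q.integrable_norm_sq μ).const_mul 2)]
  refine integral_mono ((p + q).integrable_norm_sq μ) (((p.integrable_norm_sq μ).const_mul 2).add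
    ((q.integrable_norm_sq μ).const_mul 2)) fun x => ?_
  have h := norm_add_le (p x) (q x)
  have h0 := norm_nonneg (p x + q x)
  simp only [ContinuousMap.add_apply]
  nlinarith [sq_nonneg (‖p x‖ - ‖q x‖)]

/-- Convergence to zero of second moments passes from a set to the closure of its span. -/
lemma tendsto_integral_norm_sq_of_span_dense {μ : ℕ → Measure X}
    (hμ : ∀ n, IsProbabilityMeasure (μ n)) (D : ℕ → C(X, ℂ) →ₗ[ℂ] C(X, ℂ))
    (hD : ∀ n p, ‖D n p‖ ≤ 2 * ‖p‖) {s : Set C(X, ℂ)}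
    (hs : (Submodule.span ℂ s).topologicalClosure = ⊤)
    (h : ∀ p ∈ s, Tendsto (fun n => ∫ x, ‖D n p x‖ ^ 2 ∂μ n) atTop (𝓝 0)) (p : C(X, ℂ)) :
    Tendsto (fun n => ∫ x, ‖D n p x‖ ^ 2 ∂μ n) atTop (𝓝 0) := by
  have hnonneg : ∀ n (q : C(X, ℂ)), 0 ≤ ∫ x, ‖D n q x‖ ^ 2 ∂μ n :=
    fun n q => integral_nonneg fun x => by positivity
  have hspan : ∀ q ∈ Submodule.span ℂ s,
      Tendsto (fun n => ∫ x, ‖D n q x‖ ^ 2 ∂μ n) atTop (𝓝 0) := by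
    intro q hq
    induction hq using Submodule.span_induction with
    | mem q hq => exact h q hq
    | zero => simp
    | add q r _ _ hq hr =>
      refine squeeze_zero (fun n => hnonneg n _) (fun n => ?_)
        (by simpa using (hq.const_mul 2).add (hr.const_mul 2))
      rw [map_add]
      exact integral_norm_sq_add_le (μ n) (D n q) (D n r)
    | smul c q _ hq =>
      have : (fun n => ∫ x, ‖D n (c • q) x‖ ^ 2 ∂μ n) =
          fun n => ‖c‖ ^ 2 * ∫ x, ‖D n q x‖ ^ 2 ∂μ n := by
        ext n
        simp only [map_smul, ContinuousMap.smul_apply, norm_smul, mul_pow]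
        exact integral_const_mul _ _
      rw [this]
      simpa using hq.const_mul (‖c‖ ^ 2)
  rw [Metric.tendsto_atTop]
  intro ε hε
  have hp : p ∈ closure (Submodule.span ℂ s : Set C(X, ℂ)) := by
    rw [← Submodule.topologicalClosure_coe, hs]
    trivial
  obtain ⟨q, hq, hpq⟩ := Metric.mem_closure_iff.1 hp (√ε / 4) (by positivity)
  obtain ⟨n₀, hn₀⟩ := Metric.tendsto_atTop.1 (hspan q hq) (ε / 4) (by positivity)
  refine ⟨n₀, fun n hn => ?_⟩
  have hqn := hn₀ n hn
  rw [Real.dist_0_eq_abs, abs_of_nonneg (hnonneg n _)] at hqn ⊢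
  have hsplit := integral_norm_sq_add_le (μ n) (D n q) (D n (p - q))
  rw [← map_add, add_sub_cancel] at hsplit
  have hrest : ∫ x, ‖D n (p - q) x‖ ^ 2 ∂μ n ≤ ε / 4 := by
    have : ∀ x, ‖D n (p - q) x‖ ^ 2 ≤ ε / 4 := fun x => by
      have h1 := ((D n (p - q)).norm_coe_le_norm x).trans (hD n _)
      rw [dist_eq_norm] at hpq
      have h2 : ‖D n (p - q) x‖ ≤ √ε / 2 := by linarith
      have h3 := pow_le_pow_left₀ (norm_nonneg _) h2 2
      rw [div_pow, Real.sq_sqrt hε.le] at h3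
      linarith
    refine (integral_mono ((D n (p - q)).integrable_norm_sq (μ n)) (integrable_const (ε / 4))
      this).trans (by simp)
  linarith

end SecondMoment

section WellBalanced

variable {G : Type*} [Group G] [DecidableEq G] {f : G → ℤ} {F : Finset G}

lemma WellBalancedZ.exists_laplacianData (hf : WellBalancedZ f) :
    ∃ F : Finset G, LaplacianData f F := by
  obtain ⟨hfin, hsum, hnonpos, hsymm, hcl⟩ := hf
  exact ⟨insert 1 hfin.toFinset,
    { one_mem := Finset.mem_insert_self _ _
      inv_eq := by
        ext s
        simp [hsymm]
      closure_eq := by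
        rw [← top_le_iff, ← hcl]
        exact Subgroup.closure_mono (by simp)
      symm := hsymm
      sum_eq_zero := by
        rw [← hsum, finsum_eq_sum_of_support_subset]
        simp
      le_neg_one := fun s hs hs1 => by
        have h0 : f s ≠ 0 := by simpa [hs1] using hs
        have := hnonpos s hs1
        omega
      eq_zero := fun s hs => by
        by_contra h0
        exact hs (by simp [h0]) }⟩

namespace LaplacianData

lemma mem_XfSet_iff (h : LaplacianData f F) {x : G → UnitAddCircle} :
    x ∈ XfSet f ↔ ∀ t, lap f F (MonoidHom.id G) x t = 0 := by
  refine forall_congr' fun t => ?_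
  rw [finsum_eq_sum_of_support_subset (s := F)]
  · rfl
  · intro s hs
    by_contra hsF
    exact hs (by simp [h.eq_zero s hsF])

lemma isClosed_XfSet (h : LaplacianData f F) : IsClosed (XfSet f) := by
  have : XfSet f = ⋂ t, {x | lap f F (MonoidHom.id G) x t = 0} := by
    ext x
    simp [h.mem_XfSet_iff]
  rw [this]
  refine isClosed_iInter fun t => isClosed_eq ?_ continuous_const
  unfold lap
  fun_prop

lemma isClosed_fixSet (h : LaplacianData f F) (N : Subgroup G) : IsClosed (fixSet f N) := by
  have : fixSet f N = XfSet f ∩ ⋂ γ ∈ N, ⋂ t, {x | x (γ * t) = x t} := by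
    ext x
    simp [fixSet]
  rw [this]
  exact h.isClosed_XfSet.inter (isClosed_biInter fun γ _ => isClosed_iInter fun t =>
    isClosed_eq (by fun_prop) (by fun_prop))

lemma shift_mem_XfSet (h : LaplacianData f F) {x : G → UnitAddCircle} (hx : x ∈ XfSet f) (s : G) :
    (fun t => x (s * t)) ∈ XfSet f := by
  rw [h.mem_XfSet_iff] at hx ⊢
  intro t
  simpa [lap, mul_assoc] using hx (s * t)

lemma comp_mk_mem_fixSet (h : LaplacianData f F) (N : Subgroup G) [N.Normal]
    {y : G ⧸ N → UnitAddCircle} (hy : ∀ q, lap f F (QuotientGroup.mk' N) y q = 0) :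
    (fun t => y (QuotientGroup.mk' N t)) ∈ fixSet f N := by
  refine ⟨h.mem_XfSet_iff.2 fun t => ?_, fun γ hγ t => ?_⟩
  · rw [← hy (QuotientGroup.mk' N t)]
    simp [lap]
  · have : QuotientGroup.mk' N γ = 1 := (QuotientGroup.eq_one_iff γ).2 hγ
    simp only [map_mul, this, one_mul]

lemma torusChar_lapHom_eq_one (h : LaplacianData f F) {x : G → UnitAddCircle} (hx : x ∈ XfSet f)
    (v : G →₀ ℤ) : torusChar (lapHom f F (MonoidHom.id G) v) x = 1 :=
  torusChar_apply_eq_one_iff.2 (circlePairing_lapHom_eq_zero _ (h.mem_XfSet_iff.1 hx) v)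

end LaplacianData

end WellBalanced

/-- The shift `x ↦ (t ↦ x (s⁻¹ * t))` on `(ℝ/ℤ)^G`. -/
def torusShift {G : Type*} [Group G] (s : G) : C(G → UnitAddCircle, G → UnitAddCircle) where
  toFun x t := x (s⁻¹ * t)
  continuous_toFun := by fun_prop

lemma torusChar_torusShift {G : Type*} [Group G] (g : G →₀ ℤ) (s : G) (x : G → UnitAddCircle) :
    torusChar g (torusShift s x) = torusChar (g.mapDomain (s⁻¹ * ·)) x := by
  rw [torusChar_apply, torusChar_apply, circlePairing_mapDomain]
  rfl

section Deviation

variable {G : Type*} [Group G] (N : Subgroup G) [Fintype (G ⧸ N)]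
  (μ : Measure (G → UnitAddCircle))

/-- The deviation of the average of a function over coset representatives of `N` from its
`μ`-integral. -/
noncomputable def averageDeviation [Countable G] [IsProbabilityMeasure μ] :
    C(G → UnitAddCircle, ℂ) →ₗ[ℂ] C(G → UnitAddCircle, ℂ) where
  toFun p := (N.index : ℂ)⁻¹ • ∑ c : G ⧸ N, p.comp (torusShift c.out) -
    ContinuousMap.const _ (∫ y, p y ∂μ)
  map_add' p q := by
    have hint : ∀ p : C(G → UnitAddCircle, ℂ), Integrable p μ := fun p =>
      Integrable.of_bound (by fun_prop) ‖p‖ (.of_forall p.norm_coe_le_norm)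
    ext x
    simp only [ContinuousMap.sub_apply, ContinuousMap.smul_apply, ContinuousMap.sum_apply,
      ContinuousMap.comp_apply, ContinuousMap.add_apply, ContinuousMap.const_apply,
      Finset.sum_add_distrib, integral_add (hint p) (hint q), smul_eq_mul]
    ring
  map_smul' a p := by
    ext x
    simp only [ContinuousMap.sub_apply, ContinuousMap.smul_apply, ContinuousMap.sum_apply,
      ContinuousMap.comp_apply, ContinuousMap.const_apply, integral_const_mul, smul_eq_mul,
      ← Finset.mul_sum, RingHom.id_apply]
    ring

variable [Countable G] [IsProbabilityMeasure μ]

lemma averageDeviation_apply (p : C(G → UnitAddCircle, ℂ)) (x : G → UnitAddCircle) :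
    averageDeviation N μ p x =
      (N.index : ℂ)⁻¹ * ∑ c : G ⧸ N, p (torusShift c.out x) - ∫ y, p y ∂μ := by
  simp [averageDeviation]

lemma norm_averageDeviation_le (p : C(G → UnitAddCircle, ℂ)) :
    ‖averageDeviation N μ p‖ ≤ 2 * ‖p‖ := by
  have hidx : (N.index : ℝ) = Fintype.card (G ⧸ N) := by
    rw [Subgroup.index, Nat.card_eq_fintype_card]
  have hpos : 0 < (N.index : ℝ) := by
    rw [hidx]
    exact_mod_cast Fintype.card_pos
  rw [ContinuousMap.norm_le _ (by positivity)]
  intro x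
  rw [averageDeviation_apply, two_mul]
  refine (norm_sub_le _ _).trans (add_le_add ?_ ?_)
  · rw [norm_mul, norm_inv, Complex.norm_natCast, inv_mul_le_iff₀ hpos, hidx]
    refine (norm_sum_le_of_le _ fun c _ => p.norm_coe_le_norm _).trans (by simp)
  · simpa using norm_integral_le_of_norm_le_const (μ := μ) (.of_forall p.norm_coe_le_norm)

end Deviation

/-- The second moment of a sum of characters is at most the number of correlated pairs. -/
lemma integral_norm_sq_sum_torusChar_le {G ι : Type*} [Countable G] [Fintype ι]
    (μ : Measure (G → UnitAddCircle)) [IsProbabilityMeasure μ] (g : ι → G →₀ ℤ) {K : ℕ}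
    (hK : ∀ i, {j | ∫ x, torusChar (g i - g j) x ∂μ ≠ 0}.ncard ≤ K) :
    ∫ x, ‖∑ i, torusChar (g i) x‖ ^ 2 ∂μ ≤ Fintype.card ι * K := by
  classical
  have hint : ∀ p : C(G → UnitAddCircle, ℂ), Integrable p μ := fun p =>
    Integrable.of_bound (by fun_prop) ‖p‖ (.of_forall p.norm_coe_le_norm)
  have hsq : ∀ x, ((‖∑ i, torusChar (g i) x‖ ^ 2 : ℝ) : ℂ) =
      ∑ i, ∑ j, torusChar (g i - g j) x := fun x => by
    rw [Complex.ofReal_pow, ← Complex.mul_conj', map_sum, Finset.sum_mul_sum]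
    simp only [sub_eq_add_neg, torusChar_add, torusChar_neg]
    rfl
  have heq : ((∫ x, ‖∑ i, torusChar (g i) x‖ ^ 2 ∂μ : ℝ) : ℂ) =
      ∑ i, ∑ j, ∫ x, torusChar (g i - g j) x ∂μ := by
    rw [← integral_complex_ofReal]
    simp only [hsq]
    rw [integral_finsetSum _ fun i _ => integrable_finsetSum _ fun j _ => hint _]
    exact Finset.sum_congr rfl fun i _ => integral_finsetSum _ fun j _ => hint _
  refine (le_abs_self _).trans ?_
  rw [← Real.norm_eq_abs, ← Complex.norm_real, heq]
  have hrow : ∀ i, ‖∑ j, ∫ x, torusChar (g i - g j) x ∂μ‖ ≤ K := fun i => by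
    have hterm : ∀ j, ‖∫ x, torusChar (g i - g j) x ∂μ‖ ≤
        if ∫ x, torusChar (g i - g j) x ∂μ ≠ 0 then (1 : ℝ) else 0 := fun j => by
      split_ifs with hj
      · simpa using norm_integral_le_of_norm_le_const (μ := μ)
          (.of_forall fun x => (norm_torusChar_apply (g i - g j) x).le)
      · simp [not_not.1 hj]
    refine (norm_sum_le_of_le _ fun j _ => hterm j).trans ?_
    rw [Finset.sum_boole]
    have := hK i
    rw [Set.ncard_eq_toFinset_card'] at this
    simpa using this
  refine (norm_sum_le_of_le _ fun i _ => hrow i).trans (by simp)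

section Correlation

variable {G : Type*} [Group G] [DecidableEq G] {f : G → ℤ} {F : Finset G}

lemma circlePairing_translate {Q : Type*} [Group Q] (y : Q → UnitAddCircle) (a : Q)
    (g : Q →₀ ℤ) :
    circlePairing (fun q => y (a * q)) g = circlePairing y (g.mapDomain (a * ·)) :=
  (circlePairing_mapDomain y (a * ·) g).symm

/-- If the translates of `g` by `c` and `d` pair equally with all `N`-periodic points, then
`g` and its translate by `d * c⁻¹` differ by a Laplacian on `G ⧸ N`. -/
lemma exists_lap_eq_of_forall_fixSet (h : LaplacianData f F) (N : Subgroup G) [N.Normal]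
    (g : G →₀ ℤ) (c d : G ⧸ N)
    (hcd : ∀ x ∈ fixSet f N, circlePairing x
      (g.mapDomain (c.out⁻¹ * ·) - g.mapDomain (d.out⁻¹ * ·)) = 0) :
    ∃ v : G ⧸ N → ℤ, ∀ q, lap f F (QuotientGroup.mk' N) v q =
      g.mapDomain (QuotientGroup.mk' N) q -
        g.mapDomain (QuotientGroup.mk' N) ((d * c⁻¹)⁻¹ * q) := by
  set π := QuotientGroup.mk' N with hπ
  have hout : ∀ c : G ⧸ N, π c.out = c := fun c => Quotient.out_eq' c
  obtain ⟨v, hv⟩ := exists_lapHom_eq_of_circlePairing_eq_zero (f := f) (F := F) π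
    (g.mapDomain π - (g.mapDomain π).mapDomain (d * c⁻¹ * ·)) fun y hy => by
      have hyd : ∀ q, lap f F π (fun r => y (d * r)) q = 0 := fun q => by
        simpa [lap, mul_assoc] using hy (d * q)
      have hpair : ∀ e : G ⧸ N,
          circlePairing (fun t => y (d * π t)) (g.mapDomain (e.out⁻¹ * ·)) =
            circlePairing y ((g.mapDomain π).mapDomain (d * e⁻¹ * ·)) := fun e => by
        rw [circlePairing_mapDomain, ← circlePairing_translate, circlePairing_mapDomain]
        simp only [map_mul, map_inv, hout, mul_assoc]
      have h0 := hcd _ (h.comp_mk_mem_fixSet N hyd)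
      rw [map_sub, hpair, hpair, sub_eq_zero] at h0
      rw [map_sub, h0, mul_inv_cancel]
      simp only [one_mul]
      exact sub_eq_zero.2 (congrArg _ Finsupp.mapDomain_id.symm)
  refine ⟨v, fun q => ?_⟩
  rw [← lapHom_apply π h, hv, Finsupp.sub_apply]
  congr 1
  conv_lhs => rw [← mul_inv_cancel_left (d * c⁻¹) q]
  exact Finsupp.mapDomain_apply (mul_right_injective (d * c⁻¹)) _ _

end Correlation

section Approximation

variable {G : Type*} [Group G] {N : ℕ → Subgroup G}

lemma eventually_forall_notMem
    (hconv : (⋂ n : ℕ, ⋃ i : ℕ, ⋃ (_ : n ≤ i), ((N i : Set G))) = {1})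
    (B : Finset G) :
    ∀ᶠ n in atTop, ∀ t ∈ B, t ≠ 1 → t ∉ N n := by
  rw [Filter.eventually_all_finset]
  intro t _
  by_cases ht : t = 1
  · simp [ht]
  have hmem : t ∉ ⋂ n : ℕ, ⋃ i : ℕ, ⋃ (_ : n ≤ i), ((N i : Set G)) := by
    rw [hconv]
    exact ht
  simp only [Set.mem_iInter, Set.mem_iUnion, not_forall, not_exists] at hmem
  obtain ⟨n, hn⟩ := hmem
  filter_upwards [eventually_ge_atTop n] with i hi _
  exact hn i hi

lemma eventually_injOn_mk [DecidableEq G]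
    (hconv : (⋂ n : ℕ, ⋃ i : ℕ, ⋃ (_ : n ≤ i), ((N i : Set G))) = {1})
    (B : Finset G) :
    ∀ᶠ n in atTop, Set.InjOn (QuotientGroup.mk : G → G ⧸ N n) B := by
  filter_upwards [eventually_forall_notMem hconv (B⁻¹ * B)] with n hn s hs t ht hst
  by_contra hne
  refine hn (s⁻¹ * t) (Finset.mul_mem_mul (Finset.inv_mem_inv hs) ht) ?_ (QuotientGroup.eq.1 hst)
  rwa [ne_eq, inv_mul_eq_one]

lemma tendsto_index_atTop [Infinite G]
    (hconv : (⋂ n : ℕ, ⋃ i : ℕ, ⋃ (_ : n ≤ i), ((N i : Set G))) = {1})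
    (hfin : ∀ n, (N n).FiniteIndex) :
    Tendsto (fun n => (N n).index) atTop atTop := by
  classical
  rw [tendsto_atTop]
  intro k
  obtain ⟨B, hB⟩ := Infinite.exists_subset_card_eq G k
  filter_upwards [eventually_injOn_mk hconv B] with n hn
  have := Fintype.ofFinite (G ⧸ N n)
  rw [← hB, ← Finset.card_image_of_injOn hn, Subgroup.index, Nat.card_eq_fintype_card]
  exact Finset.card_le_univ _

end Approximation

section Moments

variable {G : Type*} [Group G] [DecidableEq G] [Countable G] {f : G → ℤ} {F : Finset G}
  {lam : Measure (G → UnitAddCircle)} [IsProbabilityMeasure lam]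

lemma averageDeviation_lapHom (h : LaplacianData f F) (hsupp : lam (XfSet f) = 1)
    (N : Subgroup G) [Fintype (G ⧸ N)] {x : G → UnitAddCircle} (hx : x ∈ XfSet f) (v : G →₀ ℤ) :
    averageDeviation N lam (torusChar (lapHom f F (MonoidHom.id G) v)) x = 0 := by
  have hae : ∀ᵐ y ∂lam, y ∈ XfSet f := by
    rwa [← mem_ae_iff_prob_eq_one h.isClosed_XfSet.measurableSet] at hsupp
  have hint : ∫ y, torusChar (lapHom f F (MonoidHom.id G) v) y ∂lam = 1 := by
    rw [integral_congr_ae (g := fun _ => 1) (hae.mono fun y hy => h.torusChar_lapHom_eq_one hy v)]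
    simp
  have hidx : (N.index : ℂ) = Fintype.card (G ⧸ N) := by
    rw [Subgroup.index, Nat.card_eq_fintype_card]
  have hshift : ∀ s, torusChar (lapHom f F (MonoidHom.id G) v) (torusShift s x) = 1 := fun s =>
    h.torusChar_lapHom_eq_one (h.shift_mem_XfSet hx s⁻¹) v
  simp only [averageDeviation_apply, hint, hshift, hidx]
  simp

/-- The second moment of the deviation of a character that is nontrivial on `X_f`. -/
lemma integral_norm_sq_averageDeviation_le (h : LaplacianData f F) (N : Subgroup G) [N.Normal]
    [Fintype (G ⧸ N)] [DecidableEq (G ⧸ N)] {μ : Measure (G → UnitAddCircle)}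
    [IsProbabilityMeasure μ]
    (hinv : ∀ x ∈ fixSet f N, μ.map (fun y => y + x) = μ) {g : G →₀ ℤ}
    (hg : ∫ y, torusChar g y ∂lam = 0) {B : Finset G}
    (hB : ∀ (y : G ⧸ N) (v : G ⧸ N → ℤ), (∀ q, lap f F (QuotientGroup.mk' N) v q =
      g.mapDomain (QuotientGroup.mk' N) q - g.mapDomain (QuotientGroup.mk' N) (y⁻¹ * q)) →
        y ∈ B.image (QuotientGroup.mk' N)) :
    ∫ x, ‖averageDeviation N lam (torusChar g) x‖ ^ 2 ∂μ ≤ (N.index : ℝ)⁻¹ * #B := by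
  have hidx : N.index = Fintype.card (G ⧸ N) := by
    rw [Subgroup.index, Nat.card_eq_fintype_card]
  have hpos : 0 < (N.index : ℝ) := by
    rw [hidx]
    exact_mod_cast Fintype.card_pos
  have hsum := integral_norm_sq_sum_torusChar_le μ
    (fun c : G ⧸ N => g.mapDomain (c.out⁻¹ * ·)) (K := #B) fun c => by
      have hsub : {d : G ⧸ N | ∫ x, torusChar
          (g.mapDomain (c.out⁻¹ * ·) - g.mapDomain (d.out⁻¹ * ·)) x ∂μ ≠ 0} ⊆
          (B.image fun b => QuotientGroup.mk' N b * c : Finset (G ⧸ N)) := fun d hd => by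
        obtain ⟨v, hv⟩ := exists_lap_eq_of_forall_fixSet h N g c d fun x hx => by
          by_contra hne
          exact hd (integral_torusChar_eq_zero (hinv x hx) hne)
        obtain ⟨b, hb, hbd⟩ := Finset.mem_image.1 (hB _ v hv)
        exact Finset.mem_coe.2 (Finset.mem_image.2 ⟨b, hb, by rw [hbd, inv_mul_cancel_right]⟩)
      refine (Set.ncard_le_ncard hsub (Finset.finite_toSet _)).trans ?_
      rw [Set.ncard_coe_finset]
      exact Finset.card_image_le
  have hpoint : ∀ x, ‖averageDeviation N lam (torusChar g) x‖ ^ 2 = ((N.index : ℝ)⁻¹) ^ 2 *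
      ‖∑ c : G ⧸ N, torusChar (g.mapDomain (c.out⁻¹ * ·)) x‖ ^ 2 := fun x => by
    rw [averageDeviation_apply, hg, sub_zero, norm_mul, norm_inv, Complex.norm_natCast, mul_pow]
    simp only [torusChar_torusShift]
  simp only [hpoint]
  rw [integral_const_mul]
  refine (mul_le_mul_of_nonneg_left hsum (by positivity)).trans_eq ?_
  rw [← hidx]
  field_simp

lemma tendsto_integral_norm_sq_averageDeviation_torusChar [Infinite G] (h : LaplacianData f F)
    (hZ : ∀ N : Subgroup G, N.Normal → N.FiniteIndex → IsEmpty (N ≃* Multiplicative ℤ))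
    {N : ℕ → Subgroup G} (hnorm : ∀ n, (N n).Normal) [∀ n, Fintype (G ⧸ N n)]
    (hconv : (⋂ n : ℕ, ⋃ i : ℕ, ⋃ (_ : n ≤ i), ((N i : Set G))) = {1})
    {lamn : ℕ → Measure (G → UnitAddCircle)} (hPn : ∀ n, IsProbabilityMeasure (lamn n))
    (hsuppn : ∀ n, lamn n (fixSet f (N n)) = 1)
    (hinvn : ∀ n, ∀ x ∈ fixSet f (N n), Measure.map (fun y => y + x) (lamn n) = lamn n)
    (hsupp : lam (XfSet f) = 1)
    (hinv : ∀ x ∈ XfSet f, Measure.map (fun y => y + x) lam = lam) (g : G →₀ ℤ) :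
    Tendsto (fun n => ∫ x, ‖averageDeviation (N n) lam (torusChar g) x‖ ^ 2 ∂lamn n)
      atTop (𝓝 0) := by
  classical
  by_cases hg : ∃ v, lapHom f F (MonoidHom.id G) v = g
  · obtain ⟨v, rfl⟩ := hg
    refine tendsto_const_nhds.congr fun n => ?_
    have hae : ∀ᵐ y ∂lamn n, y ∈ fixSet f (N n) :=
      (mem_ae_iff_prob_eq_one (h.isClosed_fixSet (N n)).measurableSet).2 (hsuppn n)
    rw [integral_congr_ae (g := fun _ => 0) (hae.mono fun x hx => by
      simp [averageDeviation_lapHom h hsupp (N n) hx.1 v])]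
    simp
  obtain ⟨x, hx, hxg⟩ : ∃ x ∈ XfSet f, circlePairing x g ≠ 0 := by
    by_contra! hcon
    exact hg (exists_lapHom_eq_of_circlePairing_eq_zero _ g fun x hx =>
      hcon x (h.mem_XfSet_iff.2 hx))
  have hzero := integral_torusChar_eq_zero (hinv x hx) hxg
  obtain ⟨D, m, hDm⟩ := exists_mem_image_pow_of_lap_eq h hZ g fun ⟨v, hv⟩ =>
    hg ⟨v, Finsupp.ext fun w => by rw [lapHom_apply _ h, hv]⟩
  have hidx : Tendsto (fun n => ((N n).index : ℝ)⁻¹ * #(F ^ D)) atTop (𝓝 0) := by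
    simpa using (tendsto_inv_atTop_zero.comp (tendsto_natCast_atTop_atTop.comp
      (tendsto_index_atTop hconv fun n => Subgroup.finiteIndex_of_finite_quotient))).mul_const
        (#(F ^ D) : ℝ)
  refine tendsto_of_tendsto_of_tendsto_of_le_of_le' tendsto_const_nhds hidx
    (.of_forall fun n => integral_nonneg fun x => by positivity) ?_
  filter_upwards [eventually_injOn_mk hconv (F ^ m)] with n hn
  exact integral_norm_sq_averageDeviation_le h (N n) (hinvn n) hzero
    (hDm (QuotientGroup.mk' (N n)) (QuotientGroup.mk'_surjective _) hn)

end Moments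

/-- The `λ_n`-measure of the set of `Γ_n`-periodic points whose empirical average of `p`
deviates from `∫ p dλ` by more than `δ` tends to `0`. -/
theorem stmt18 {G : Type*} [Group G] [Countable G] [Infinite G]
    (hZ : ∀ N : Subgroup G, N.Normal → N.FiniteIndex →
      IsEmpty (N ≃* Multiplicative ℤ) ∧ IsEmpty (N ≃* Multiplicative (ℤ × ℤ)))
    (f : G → ℤ) (hf : WellBalancedZ f)
    (N : ℕ → Subgroup G) (hnorm : ∀ n, (N n).Normal) (hfin : ∀ n, (N n).FiniteIndex)
    (hconv : (⋂ n : ℕ, ⋃ i : ℕ, ⋃ (_ : n ≤ i), ((N i : Set G))) = {1})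
    (lamn : ℕ → Measure (G → UnitAddCircle))
    (hPn : ∀ n, IsProbabilityMeasure (lamn n))
    (hsuppn : ∀ n, lamn n (fixSet f (N n)) = 1)
    (hinvn : ∀ n, ∀ x ∈ fixSet f (N n),
      Measure.map (fun y => y + x) (lamn n) = lamn n)
    (lam : Measure (G → UnitAddCircle)) [IsProbabilityMeasure lam]
    (hsupp : lam (XfSet f) = 1)
    (hinv : ∀ x ∈ XfSet f, Measure.map (fun y => y + x) lam = lam)
    (p : (G → UnitAddCircle) → ℝ) (hp : Continuous p) (δ : ℝ) (hδ : 0 < δ) :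
    Tendsto
      (fun n : ℕ => lamn n
        {x | x ∈ fixSet f (N n) ∧ δ < |empAvg (N n) p x - ∫ y, p y ∂lam|})
      atTop (𝓝 0) := by
  classical
  obtain ⟨F, h⟩ := hf.exists_laplacianData
  have : ∀ n, Fintype (G ⧸ N n) := fun n => Fintype.ofFinite _
  let q : C(G → UnitAddCircle, ℂ) := ⟨fun x => (p x : ℂ), by fun_prop⟩
  have hmoment := tendsto_integral_norm_sq_of_span_dense hPn (fun n => averageDeviation (N n) lam)
    (fun n => norm_averageDeviation_le (N n) lam) span_torusChar_closure_eq_top (by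
      rintro - ⟨g, rfl⟩
      exact tendsto_integral_norm_sq_averageDeviation_torusChar h
        (fun N hN hN' => (hZ N hN hN').1) hnorm hconv hPn hsuppn hinvn hsupp hinv g) q
  have hdev : ∀ n x, ‖averageDeviation (N n) lam q x‖ =
      |empAvg (N n) p x - ∫ y, p y ∂lam| := fun n x => by
    rw [averageDeviation_apply, ← Real.norm_eq_abs, ← Complex.norm_real, empAvg,
      finsum_eq_sum_of_fintype]
    push_cast
    rw [← integral_complex_ofReal]
    rfl
  have hbound : ∀ n, lamn n {x | x ∈ fixSet f (N n) ∧ δ < |empAvg (N n) p x - ∫ y, p y ∂lam|} ≤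
      ENNReal.ofReal ((∫ x, ‖averageDeviation (N n) lam q x‖ ^ 2 ∂lamn n) / δ ^ 2) := fun n => by
    rw [← ofReal_measureReal]
    refine ENNReal.ofReal_le_ofReal ?_
    rw [le_div_iff₀' (by positivity)]
    refine le_trans ?_ (mul_meas_ge_le_integral_of_nonneg (.of_forall fun x => by positivity)
      ((averageDeviation (N n) lam q).integrable_norm_sq (lamn n)) (δ ^ 2))
    refine mul_le_mul_of_nonneg_left (measureReal_mono fun x hx => ?_) (by positivity)
    change δ ^ 2 ≤ ‖averageDeviation (N n) lam q x‖ ^ 2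
    rw [hdev]
    exact pow_le_pow_left₀ hδ.le hx.2.le 2
  refine tendsto_of_tendsto_of_tendsto_of_le_of_le tendsto_const_nhds ?_ (fun n => zero_le)
    hbound
  simpa using ENNReal.tendsto_ofReal (hmoment.div_const (δ ^ 2))
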